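/- arXiv:2404.03351 — 5 statements merged into one kernel-verified Lean document; each statement's English description precedes it below -/
import Mathlib

section
/- For every q = (q₁, q₂) ∈ ℂ² and all vectors u, v ∈ ℂ³, one has J·Q(q)²·(u × v) + (J·(Q(q)ᵀ)²·u) × v + u × (J·(Q(q)ᵀ)²·v) = 0, where J = diag(1, −1, −1), Q(q)ᵀ is the transpose of Q(q), and × denotes the cross product on ℂ³. -/
open Matrix

/-- The matrix `J = diag(1, -1, -1)` over `ℂ`. -/
noncomputable def Jm : Matrix (Fin 3) (Fin 3) ℂ := Matrix.diagonal ![1, -1, -1]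

/-- The matrix `Q(q)` for `q = (q₁, q₂) ∈ ℂ²`: first row `(0, conj q₁, conj q₂)`,
first column `(0, −q₁, −q₂)ᵀ`, all other entries `0`. -/
noncomputable def Qm (q : Fin 2 → ℂ) : Matrix (Fin 3) (Fin 3) ℂ :=
  !![0, (starRingEnd ℂ) (q 0), (starRingEnd ℂ) (q 1);
     -q 0, 0, 0;
     -q 1, 0, 0]

/-- Fourth identity of eq. (2.46):
`J Q(q)² (u × v) + (J (Q(q)ᵀ)² u) × v + u × (J (Q(q)ᵀ)² v) = 0`. -/
theorem stmt2 (q : Fin 2 → ℂ) (u v : Fin 3 → ℂ) :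
    (Jm * (Qm q * Qm q)).mulVec (crossProduct u v)
      + crossProduct ((Jm * ((Qm q)ᵀ * (Qm q)ᵀ)).mulVec u) v
      + crossProduct u ((Jm * ((Qm q)ᵀ * (Qm q)ᵀ)).mulVec v) = 0 := by
  have hJ : Jm = !![1, 0, 0; 0, -1, 0; 0, 0, -1] := by
    ext i j
    fin_cases i <;> fin_cases j <;> simp [Jm]
  have hQT : (Qm q)ᵀ = !![0, -q 0, -q 1;
      (starRingEnd ℂ) (q 0), 0, 0; (starRingEnd ℂ) (q 1), 0, 0] := by
    ext i j
    fin_cases i <;> fin_cases j <;> simp [Qm]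
  rw [hQT, hJ, Qm, cross_apply, cross_apply, cross_apply]
  ext i
  fin_cases i <;>
    simp [Matrix.mulVec, dotProduct, Matrix.mul_apply, Fin.sum_univ_three,
      Matrix.vecHead, Matrix.vecTail] <;>
    ring
end

section
/- (Spatial part of Proposition 1.) Let k ∈ ℂ and let q : ℝ → ℂ² be continuous. Define Ã(x) = i k J + conj(Q(q(x))), where conj denotes the entrywise complex conjugate of the matrix. If ṽ₁, ṽ₂ : ℝ → ℂ³ are differentiable and satisfy ṽⱼ'(x) = Ã(x) ṽⱼ(x) for j = 1, 2 and all x ∈ ℝ, then the function v(x) := e^{i k x} (ṽ₁(x) × ṽ₂(x)) satisfies v'(x) = (−i k J + Q(q(x))) v(x) for all x ∈ ℝ. -/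
open Matrix

/-- Spatial part of Proposition 1: if `ṽ₁, ṽ₂` solve the adjoint spatial problem
`ṽ' = (ikJ + conj(Q(q(x)))) ṽ`, then `v(x) = e^{ikx} (ṽ₁(x) × ṽ₂(x))` solves the
spatial Lax problem `v' = (−ikJ + Q(q(x))) v`. -/
theorem stmt3 (k : ℂ) (q : ℝ → Fin 2 → ℂ) (hq : Continuous q)
    (v₁ v₂ : ℝ → Fin 3 → ℂ)
    (hv₁ : ∀ x : ℝ, HasDerivAt v₁
      (((Complex.I * k) • Jm + (Qm (q x)).map (starRingEnd ℂ)).mulVec (v₁ x)) x)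
    (hv₂ : ∀ x : ℝ, HasDerivAt v₂
      (((Complex.I * k) • Jm + (Qm (q x)).map (starRingEnd ℂ)).mulVec (v₂ x)) x) :
    ∀ x : ℝ, HasDerivAt
      (fun y : ℝ => Complex.exp (Complex.I * k * y) • crossProduct (v₁ y) (v₂ y))
      (((-(Complex.I * k)) • Jm + Qm (q x)).mulVec
        (Complex.exp (Complex.I * k * x) • crossProduct (v₁ x) (v₂ x))) x := by
  intro x
  have h1 := fun i => (hasDerivAt_pi.1 (hv₁ x)) i
  have h2 := fun i => (hasDerivAt_pi.1 (hv₂ x)) i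
  have he : HasDerivAt (fun y : ℝ => Complex.exp (Complex.I * k * y))
      (Complex.exp (Complex.I * k * x) * (Complex.I * k)) x := by
    have h := ((hasDerivAt_id (x : ℂ)).const_mul (Complex.I * k)).cexp.comp_ofReal
    simpa using h
  have key : ∀ a b : Fin 3, HasDerivAt
      (fun y : ℝ => Complex.exp (Complex.I * k * y) * (v₁ y a * v₂ y b - v₁ y b * v₂ y a)) _ x :=
    fun a b => he.mul (((h1 a).mul (h2 b)).sub ((h1 b).mul (h2 a)))
  rw [hasDerivAt_pi]
  intro i
  fin_cases i
  · have h := key 1 2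
    simp only [cross_apply]
    refine HasDerivAt.congr_deriv h ?_
    simp [Jm, Qm, Matrix.mulVec, dotProduct, Fin.sum_univ_three, Matrix.diagonal, cross_apply]
    ring
  · have h := key 2 0
    simp only [cross_apply]
    refine HasDerivAt.congr_deriv h ?_
    simp [Jm, Qm, Matrix.mulVec, dotProduct, Fin.sum_univ_three, Matrix.diagonal, cross_apply]
    ring
  · have h := key 0 1
    simp only [cross_apply]
    refine HasDerivAt.congr_deriv h ?_
    simp [Jm, Qm, Matrix.mulVec, dotProduct, Fin.sum_univ_three, Matrix.diagonal, cross_apply]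
    ring
end

section
/- (Spatial part of Proposition 2, first symmetry.) Let k ∈ ℂ and let q : ℝ → ℂ² be continuous. If ψ : ℝ → M₃(ℂ) is differentiable, ψ(x) is invertible for every x ∈ ℝ, and ψ'(x) = (−i·conj(k)·J + Q(q(x))) ψ(x) for all x, then the function N(x) := (ψ(x)†)⁻¹ (the inverse of the conjugate transpose) is differentiable and satisfies N'(x) = (−i k J + Q(q(x))) N(x) for all x ∈ ℝ. -/
open Matrix

attribute [local instance] Matrix.linftyOpNormedRing Matrix.linftyOpNormedAlgebra in
/-- Entrywise derivative of the matrix inverse. -/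
theorem hasDerivAt_inv_entries (A : ℝ → Matrix (Fin 3) (Fin 3) ℂ)
    (A' : Matrix (Fin 3) (Fin 3) ℂ) (x : ℝ) (hu : IsUnit (A x))
    (hA : ∀ i j, HasDerivAt (fun y => A y i j) (A' i j) x) (i j : Fin 3) :
    HasDerivAt (fun y => (A y)⁻¹ i j) ((-((A x)⁻¹ * A' * (A x)⁻¹)) i j) x := by
  have h1 : HasDerivAt A A' x := by
    refine hasDerivAt_pi.2 fun i => hasDerivAt_pi.2 fun j => hA i j
  obtain ⟨u, hu⟩ := hu
  have h2 := hasFDerivAt_ringInverse (𝕜 := ℝ) u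
  rw [hu] at h2
  have h3 := h2.comp_hasDerivAt x h1
  have hi : ((u⁻¹ : (Matrix (Fin 3) (Fin 3) ℂ)ˣ) : Matrix (Fin 3) (Fin 3) ℂ) = (A x)⁻¹ := by
    rw [← hu, Matrix.coe_units_inv]
  have h4 : HasDerivAt (fun y => (A y)⁻¹) (-((A x)⁻¹ * A' * (A x)⁻¹)) x := by
    have e1 : (fun y => (A y)⁻¹) = Ring.inverse ∘ A := by
      funext y
      simp [Matrix.nonsing_inv_eq_ringInverse]
    have e2 : -((A x)⁻¹ * A' * (A x)⁻¹) = (-((ContinuousLinearMap.mulLeftRight ℝ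
        (Matrix (Fin 3) (Fin 3) ℂ)) ↑u⁻¹) ↑u⁻¹) A' := by
      rw [hi]
      rfl
    rw [e1, e2]
    exact h3
  exact hasDerivAt_pi.1 (hasDerivAt_pi.1 h4 i) j

/-- Spatial part of Proposition 2 (first symmetry): if `ψ` is an invertible-matrix
solution of `ψ' = (−i conj(k) J + Q(q(x))) ψ`, then `N(x) = (ψ(x)†)⁻¹` is differentiable
and satisfies `N' = (−i k J + Q(q(x))) N`. -/
theorem stmt4 (k : ℂ) (q : ℝ → Fin 2 → ℂ) (hq : Continuous q)
    (ψ : ℝ → Matrix (Fin 3) (Fin 3) ℂ)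
    (hinv : ∀ x : ℝ, IsUnit (ψ x).det)
    (hψ : ∀ x : ℝ, ∀ i j : Fin 3, HasDerivAt (fun y : ℝ => ψ y i j)
      ((((-(Complex.I * (starRingEnd ℂ) k)) • Jm + Qm (q x)) * ψ x) i j) x) :
    ∀ x : ℝ, ∀ i j : Fin 3, HasDerivAt (fun y : ℝ => ((ψ y)ᴴ)⁻¹ i j)
      ((((-(Complex.I * k)) • Jm + Qm (q x)) * ((ψ x)ᴴ)⁻¹) i j) x := by
  intro x i j
  have hu : IsUnit ((ψ x)ᴴ) := by
    rw [Matrix.isUnit_iff_isUnit_det, Matrix.det_conjTranspose]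
    exact (hinv x).star
  have hJ : Jmᴴ = Jm := by
    ext a b
    fin_cases a <;> fin_cases b <;> simp [Jm]
  have hQ : (Qm (q x))ᴴ = -Qm (q x) := by
    ext a b
    fin_cases a <;> fin_cases b <;> simp [Qm]
  have h := hasDerivAt_inv_entries (fun y => (ψ y)ᴴ)
    ((((-(Complex.I * (starRingEnd ℂ) k)) • Jm + Qm (q x)) * ψ x)ᴴ) x hu
    (fun a b => (hψ x b a).star) i j
  convert h using 1
  have e : (((-(Complex.I * (starRingEnd ℂ) k)) • Jm + Qm (q x)) * ψ x)ᴴ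
      = -((ψ x)ᴴ * ((-(Complex.I * k)) • Jm + Qm (q x))) := by
    rw [Matrix.conjTranspose_mul, Matrix.conjTranspose_add, Matrix.conjTranspose_smul, hJ, hQ,
      ← Matrix.mul_neg]
    congr 1
    simp
    abel
  have hd := (Matrix.isUnit_iff_isUnit_det _).1 hu
  rw [e, Matrix.mul_neg, Matrix.neg_mul, neg_neg, Matrix.nonsing_inv_mul_cancel_left _ _ hd]
end

section
/- (Eigenvector relation (2.19), t-part.) Fix q₀ > 0, σ ∈ ℝ, let q₊ ∈ ℂ² with ‖q₊‖ = q₀, and let z ∈ ℂ, z ≠ 0. With k = k(z) = (z − q₀²/z)/2 and λ = λ(z) = (z + q₀²/z)/2, define E₊ = (−8iσk⁴ + i q₀² + 3iσ q₀⁴) J + 8σk³ Q(q₊) + 4ik² (J₁ − σ J Q(q₊)²) − 2k(2σq₀² + 1) Q(q₊) + i(1 + 3σq₀²) J Q(q₊)², where J₁ = diag(1, 0, 0), and define Λ₂ = diag( −2λ(k − 4k³σ + 2kσq₀²) − 2k², 3σq₀⁴ + q₀² − 8k⁴σ, 2λ(k − 4k³σ + 2kσq₀²) − 2k² ). Then E₊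 · Y₊(z) = −i · Y₊(z) · Λ₂. -/
open Matrix

/-- The matrix `J₁ = diag(1, 0, 0)` over `ℂ`. -/
noncomputable def J1 : Matrix (Fin 3) (Fin 3) ℂ := Matrix.diagonal ![1, 0, 0]

/-- The uniformization map `k(z) = (z − q₀²/z)/2`. -/
noncomputable def kf (q₀ : ℝ) (z : ℂ) : ℂ := (z - (q₀ : ℂ) ^ 2 / z) / 2

/-- The uniformization map `λ(z) = (z + q₀²/z)/2`. -/
noncomputable def lf (q₀ : ℝ) (z : ℂ) : ℂ := (z + (q₀ : ℂ) ^ 2 / z) / 2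

/-- The eigenvector matrix `Y₊(z)` of eq. (2.17). -/
noncomputable def Yp (q₀ : ℝ) (qp : Fin 2 → ℂ) (z : ℂ) : Matrix (Fin 3) (Fin 3) ℂ :=
  !![1, 0, -Complex.I * (q₀ : ℂ) / z;
     -(Complex.I / z) * qp 0, (starRingEnd ℂ) (qp 1) / (q₀ : ℂ), qp 0 / (q₀ : ℂ);
     -(Complex.I / z) * qp 1, -(starRingEnd ℂ) (qp 0) / (q₀ : ℂ), qp 1 / (q₀ : ℂ)]

/-- The asymptotic time-part Lax matrix `E₊` of eq. (2.6). -/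
noncomputable def Ep (σ q₀ : ℝ) (k : ℂ) (qp : Fin 2 → ℂ) : Matrix (Fin 3) (Fin 3) ℂ :=
  (-8 * Complex.I * (σ : ℂ) * k ^ 4 + Complex.I * (q₀ : ℂ) ^ 2
      + 3 * Complex.I * (σ : ℂ) * (q₀ : ℂ) ^ 4) • Jm
    + (8 * (σ : ℂ) * k ^ 3) • Qm qp
    + (4 * Complex.I * k ^ 2) • (J1 - (σ : ℂ) • (Jm * (Qm qp * Qm qp)))
    - (2 * k * (2 * (σ : ℂ) * (q₀ : ℂ) ^ 2 + 1)) • Qm qp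
    + (Complex.I * (1 + 3 * (σ : ℂ) * (q₀ : ℂ) ^ 2)) • (Jm * (Qm qp * Qm qp))

/-- Eigenvector relation (2.19), t-part: `E₊ Y₊(z) = −i Y₊(z) Λ₂`. -/
theorem stmt7 (q₀ : ℝ) (hq₀ : 0 < q₀) (σ : ℝ) (qp : EuclideanSpace ℂ (Fin 2))
    (hqp : ‖qp‖ = q₀) (z : ℂ) (hz : z ≠ 0) :
    Ep σ q₀ (kf q₀ z) qp * Yp q₀ qp z
      = (-Complex.I) • (Yp q₀ qp z * Matrix.diagonal
          ![-2 * lf q₀ z * (kf q₀ z - 4 * kf q₀ z ^ 3 * (σ : ℂ)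
                + 2 * kf q₀ z * (σ : ℂ) * (q₀ : ℂ) ^ 2) - 2 * kf q₀ z ^ 2,
            3 * (σ : ℂ) * (q₀ : ℂ) ^ 4 + (q₀ : ℂ) ^ 2 - 8 * kf q₀ z ^ 4 * (σ : ℂ),
            2 * lf q₀ z * (kf q₀ z - 4 * kf q₀ z ^ 3 * (σ : ℂ)
                + 2 * kf q₀ z * (σ : ℂ) * (q₀ : ℂ) ^ 2) - 2 * kf q₀ z ^ 2]) := by
  have hN : (starRingEnd ℂ) (qp 0) * qp 0 + (starRingEnd ℂ) (qp 1) * qp 1 = (q₀ : ℂ) ^ 2 := by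
    have h := EuclideanSpace.norm_sq_eq qp
    rw [hqp, Fin.sum_univ_two] at h
    rw [← Complex.normSq_eq_conj_mul_self, ← Complex.normSq_eq_conj_mul_self,
      Complex.normSq_eq_norm_sq, Complex.normSq_eq_norm_sq]
    exact_mod_cast h.symm
  have hI : Complex.I ^ 2 = -1 := Complex.I_sq
  have hq : (q₀ : ℂ) ≠ 0 := by exact_mod_cast hq₀.ne'
  have hzl : lf q₀ z + kf q₀ z = z := by unfold lf kf; ring
  have hql : (lf q₀ z - kf q₀ z) * z = (q₀ : ℂ) ^ 2 := by
    unfold lf kf; field_simp; ring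
  unfold Ep Yp Jm J1 Qm
  generalize lf q₀ z = l at *
  generalize kf q₀ z = k at *
  generalize (starRingEnd ℂ) (qp 0) = a at *
  generalize (starRingEnd ℂ) (qp 1) = b at *
  generalize qp 0 = c at *
  generalize qp 1 = d at *
  generalize (q₀ : ℂ) = r at *
  generalize (σ : ℂ) = s at *
  generalize Complex.I = I at *
  ext i j
  fin_cases i <;> fin_cases j <;>
    simp [Matrix.mul_apply, Fin.sum_univ_three, Matrix.diagonal_apply, Matrix.vecMul_diagonal] <;> field_simp <;> grind
end

section
/- (Zero-curvature / Lax pair compatibility, eqs. (2.1)–(2.4).) Fix σ ∈ ℝ, q₀ ≥ 0, k ∈ ℂ, and let q : ℝ × ℝ → ℂ² be smooth. Define, at each point (x, t), A = −i k J + Q, and E = 2k[σ(Q_x Q − Q Q_x) − 2σ‖q‖² Q − σ Q_{xx} − Q] + i q₀² J + 3iσ q₀⁴ J + 4ik²[J₁ + σ J (Q_x − Q²)] + 8σk³ Q − 8iσk⁴ J + 3iσ J (Q_x Q² + Q² Q_x) + iσ J (Q_{xx} Q + Q Q_{xx} − Q_{xxx} − Q_x²) + i(1 + 3σ‖q‖²)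 J Q² − i J Q_x, where Q = Q(q(x,t)) and subscripts denote partial x-derivatives. If q satisfies the coupled Lakshmanan–Porsezian–Daniel equation with background q₀, then at every (x, t) one has ∂_t A − ∂_x E + A E − E A = 0. -/
open Matrix

/-- Hermitian pairing `v†w = conj(v₁)w₁ + conj(v₂)w₂` on `ℂ²`. -/
noncomputable def dagger (v w : Fin 2 → ℂ) : ℂ :=
  (starRingEnd ℂ) (v 0) * w 0 + (starRingEnd ℂ) (v 1) * w 1

/-- Partial `x`-derivative of a `ℂ²`-valued field. -/
noncomputable def Dx (q : ℝ → ℝ → Fin 2 → ℂ) : ℝ → ℝ → Fin 2 → ℂ :=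
  fun x t => deriv (fun y => q y t) x

/-- Partial `t`-derivative of a `ℂ²`-valued field. -/
noncomputable def Dt (q : ℝ → ℝ → Fin 2 → ℂ) : ℝ → ℝ → Fin 2 → ℂ :=
  fun x t => deriv (fun s => q x s) t

/-- The coupled Lakshmanan–Porsezian–Daniel equation with background `q₀` (eq. (1.1)). -/
def LPD (σ q₀ : ℝ) (q : ℝ → ℝ → Fin 2 → ℂ) : Prop :=
  ∀ x t : ℝ,
    Complex.I • Dt q x t + Dx (Dx q) x t
      + (2 * (dagger (q x t) (q x t) - (q₀ : ℂ) ^ 2)) • q x t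
      + (σ : ℂ) •
          (Dx (Dx (Dx (Dx q))) x t
            + (2 * dagger (Dx q x t) (Dx q x t)) • q x t
            + (2 * dagger (Dx q x t) (q x t)) • Dx q x t
            + (6 * dagger (q x t) (Dx q x t)) • Dx q x t
            + (4 * dagger (q x t) (q x t)) • Dx (Dx q) x t
            + (4 * dagger (q x t) (Dx (Dx q) x t)) • q x t
            + (2 * dagger (Dx (Dx q) x t) (q x t)) • q x t
            + (6 * (dagger (q x t) (q x t) ^ 2 - (q₀ : ℂ) ^ 4)) • q x t)
      = 0

/-- The matrix field `Q(x,t) = Q(q(x,t))`. -/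
noncomputable def QM (q : ℝ → ℝ → Fin 2 → ℂ) : ℝ → ℝ → Matrix (Fin 3) (Fin 3) ℂ :=
  fun x t => Qm (q x t)

/-- Entrywise partial `x`-derivative of a matrix field. -/
noncomputable def DxM (M : ℝ → ℝ → Matrix (Fin 3) (Fin 3) ℂ) :
    ℝ → ℝ → Matrix (Fin 3) (Fin 3) ℂ :=
  fun x t => Matrix.of fun i j => deriv (fun y => M y t i j) x

/-- Entrywise partial `t`-derivative of a matrix field. -/
noncomputable def DtM (M : ℝ → ℝ → Matrix (Fin 3) (Fin 3) ℂ) :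
    ℝ → ℝ → Matrix (Fin 3) (Fin 3) ℂ :=
  fun x t => Matrix.of fun i j => deriv (fun s => M x s i j) t

/-- The spatial Lax matrix `A = −ikJ + Q` of eq. (2.2). -/
noncomputable def Amat (k : ℂ) (q : ℝ → ℝ → Fin 2 → ℂ) :
    ℝ → ℝ → Matrix (Fin 3) (Fin 3) ℂ :=
  fun x t => (-(Complex.I * k)) • Jm + QM q x t

/-- The temporal Lax matrix `E` of eq. (2.2). -/
noncomputable def Emat (σ q₀ : ℝ) (k : ℂ) (q : ℝ → ℝ → Fin 2 → ℂ) :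
    ℝ → ℝ → Matrix (Fin 3) (Fin 3) ℂ :=
  fun x t =>
    (2 * k) • ((σ : ℂ) • (DxM (QM q) x t * QM q x t - QM q x t * DxM (QM q) x t)
        - (2 * (σ : ℂ) * dagger (q x t) (q x t)) • QM q x t
        - (σ : ℂ) • DxM (DxM (QM q)) x t - QM q x t)
      + (Complex.I * (q₀ : ℂ) ^ 2) • Jm
      + (3 * Complex.I * (σ : ℂ) * (q₀ : ℂ) ^ 4) • Jm
      + (4 * Complex.I * k ^ 2) •
          (J1 + (σ : ℂ) • (Jm * (DxM (QM q) x t - QM q x t * QM q x t)))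
      + (8 * (σ : ℂ) * k ^ 3) • QM q x t
      - (8 * Complex.I * (σ : ℂ) * k ^ 4) • Jm
      + (3 * Complex.I * (σ : ℂ)) •
          (Jm * (DxM (QM q) x t * (QM q x t * QM q x t)
            + (QM q x t * QM q x t) * DxM (QM q) x t))
      + (Complex.I * (σ : ℂ)) •
          (Jm * (DxM (DxM (QM q)) x t * QM q x t + QM q x t * DxM (DxM (QM q)) x t
            - DxM (DxM (DxM (QM q))) x t - DxM (QM q) x t * DxM (QM q) x t))
      + (Complex.I * (1 + 3 * (σ : ℂ) * dagger (q x t) (q x t))) •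
          (Jm * (QM q x t * QM q x t))
      - Complex.I • (Jm * DxM (QM q) x t)

/-- Entrywise derivative of a matrix curve. -/
def HD (M : ℝ → Matrix (Fin 3) (Fin 3) ℂ) (M' : Matrix (Fin 3) (Fin 3) ℂ) (x : ℝ) : Prop :=
  ∀ i j, HasDerivAt (fun y => M y i j) (M' i j) x

theorem HD.add {M N : ℝ → Matrix (Fin 3) (Fin 3) ℂ} {M' N' : Matrix (Fin 3) (Fin 3) ℂ} {x : ℝ}
    (h : HD M M' x) (g : HD N N' x) : HD (fun y => M y + N y) (M' + N') x :=
  fun i j => (h i j).add (g i j)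

theorem HD.sub {M N : ℝ → Matrix (Fin 3) (Fin 3) ℂ} {M' N' : Matrix (Fin 3) (Fin 3) ℂ} {x : ℝ}
    (h : HD M M' x) (g : HD N N' x) : HD (fun y => M y - N y) (M' - N') x :=
  fun i j => (h i j).sub (g i j)

theorem HD.const (C : Matrix (Fin 3) (Fin 3) ℂ) (x : ℝ) : HD (fun _ => C) 0 x :=
  fun i j => hasDerivAt_const x (C i j)

theorem HD.smul {M : ℝ → Matrix (Fin 3) (Fin 3) ℂ} {M' : Matrix (Fin 3) (Fin 3) ℂ} {x : ℝ}
    {f : ℝ → ℂ} {f' : ℂ} (hf : HasDerivAt f f' x)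
    (h : HD M M' x) : HD (fun y => f y • M y) (f' • M x + f x • M') x :=
  fun i j => hf.mul (h i j)

theorem HD.csmul {M : ℝ → Matrix (Fin 3) (Fin 3) ℂ} {M' : Matrix (Fin 3) (Fin 3) ℂ} {x : ℝ}
    (c : ℂ) (h : HD M M' x) : HD (fun y => c • M y) (c • M') x :=
  fun i j => (h i j).const_mul c

theorem HD.mul {M N : ℝ → Matrix (Fin 3) (Fin 3) ℂ} {M' N' : Matrix (Fin 3) (Fin 3) ℂ} {x : ℝ}
    (h : HD M M' x) (g : HD N N' x) : HD (fun y => M y * N y) (M' * N x + M x * N') x := by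
  intro i j
  have := HasDerivAt.fun_sum (u := Finset.univ) (fun l _ => (h i l).mul (g l j))
  simpa [Matrix.mul_apply, Finset.sum_add_distrib] using this

theorem HD.cmul {M : ℝ → Matrix (Fin 3) (Fin 3) ℂ} {M' : Matrix (Fin 3) (Fin 3) ℂ} {x : ℝ}
    (C : Matrix (Fin 3) (Fin 3) ℂ) (h : HD M M' x) : HD (fun y => C * M y) (C * M') x := by
  simpa using (HD.const C x).mul h

theorem hasDerivAt_conj {f : ℝ → ℂ} {f' : ℂ} {x : ℝ} (h : HasDerivAt f f' x) :
    HasDerivAt (fun y => (starRingEnd ℂ) (f y)) ((starRingEnd ℂ) f') x :=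
  (Complex.conjCLE.toContinuousLinearMap.hasFDerivAt.comp_hasDerivAt x h)

/-- Smooth fields. -/
def Sm (q : ℝ → ℝ → Fin 2 → ℂ) : Prop := ContDiff ℝ (⊤ : ℕ∞) (Function.uncurry q)

theorem Sm.hx {q : ℝ → ℝ → Fin 2 → ℂ} (h : Sm q) (x t : ℝ) :
    HasDerivAt (fun y => q y t) (Dx q x t) x := by
  have h1 : ContDiff ℝ (⊤ : ℕ∞) (fun y : ℝ => Function.uncurry q (y, t)) :=
    h.comp (contDiff_id.prodMk contDiff_const)
  exact (h1.differentiable (by simp) x).hasDerivAt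

theorem Sm.ht {q : ℝ → ℝ → Fin 2 → ℂ} (h : Sm q) (x t : ℝ) :
    HasDerivAt (fun s => q x s) (Dt q x t) t := by
  have h1 : ContDiff ℝ (⊤ : ℕ∞) (fun s : ℝ => Function.uncurry q (x, s)) :=
    h.comp (contDiff_const.prodMk contDiff_id)
  exact (h1.differentiable (by simp) t).hasDerivAt

theorem Sm.dx {q : ℝ → ℝ → Fin 2 → ℂ} (h : Sm q) : Sm (Dx q) := by
  have h2 : Function.uncurry (Dx q) = fun p => fderiv ℝ (Function.uncurry q) p (1, 0) := by
    funext p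
    obtain ⟨x, t⟩ := p
    have hd := (h.differentiable (by simp) (x, t)).hasFDerivAt
    have hl : HasDerivAt (fun y : ℝ => (y, t)) ((1 : ℝ), (0 : ℝ)) x :=
      (hasDerivAt_id x).prodMk (hasDerivAt_const x t)
    have hc := HasFDerivAt.comp_hasDerivAt (l := Function.uncurry q) x hd hl
    exact (h.hx x t).unique hc
  unfold Sm
  rw [h2]
  exact (h.fderiv_right (m := (⊤ : ℕ∞)) (by simp)).clm_apply contDiff_const

theorem hd_Qm {f : ℝ → Fin 2 → ℂ} {f' : Fin 2 → ℂ} {x : ℝ} (h : HasDerivAt f f' x) :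
    HD (fun y => Qm (f y)) (Qm f') x := by
  have h0 := hasDerivAt_pi.1 h 0
  have h1 := hasDerivAt_pi.1 h 1
  intro i j
  fin_cases i <;> fin_cases j <;>
    first
    | exact hasDerivAt_const x (0 : ℂ)
    | exact hasDerivAt_conj h0
    | exact hasDerivAt_conj h1
    | exact h0.neg
    | exact h1.neg

theorem HD.dxm {M : ℝ → ℝ → Matrix (Fin 3) (Fin 3) ℂ} {M' : Matrix (Fin 3) (Fin 3) ℂ} {x t : ℝ}
    (h : HD (fun y => M y t) M' x) : DxM M x t = M' := by
  ext i j
  exact (h i j).deriv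

theorem Sm.hdx {q : ℝ → ℝ → Fin 2 → ℂ} (h : Sm q) (x t : ℝ) :
    HD (fun y => QM q y t) (QM (Dx q) x t) x := hd_Qm (h.hx x t)

theorem Sm.dxQ {q : ℝ → ℝ → Fin 2 → ℂ} (h : Sm q) : DxM (QM q) = QM (Dx q) := by
  funext x t
  exact (h.hdx x t).dxm

theorem Sm.hdag {q : ℝ → ℝ → Fin 2 → ℂ} (h : Sm q) (x t : ℝ) :
    HasDerivAt (fun y => dagger (q y t) (q y t))
      (dagger (Dx q x t) (q x t) + dagger (q x t) (Dx q x t)) x := by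
  have h0 := hasDerivAt_pi.1 (h.hx x t) 0
  have h1 := hasDerivAt_pi.1 (h.hx x t) 1
  have h2 := ((hasDerivAt_conj h0).mul h0).add ((hasDerivAt_conj h1).mul h1)
  have h3 : dagger (Dx q x t) (q x t) + dagger (q x t) (Dx q x t) =
      (starRingEnd ℂ) (Dx q x t 0) * q x t 0 + (starRingEnd ℂ) (q x t 0) * Dx q x t 0 +
      ((starRingEnd ℂ) (Dx q x t 1) * q x t 1 + (starRingEnd ℂ) (q x t 1) * Dx q x t 1) := by
    simp only [dagger]
    ring
  rw [h3]
  exact h2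

/-- The matrix `E` as a function of the jet of `Q`. -/
noncomputable def Ej (s c k n : ℂ) (Q Q1 Q2 Q3 : Matrix (Fin 3) (Fin 3) ℂ) :
    Matrix (Fin 3) (Fin 3) ℂ :=
  (2 * k) • (s • (Q1 * Q - Q * Q1) - (2 * s * n) • Q - s • Q2 - Q)
      + (Complex.I * c ^ 2) • Jm
      + (3 * Complex.I * s * c ^ 4) • Jm
      + (4 * Complex.I * k ^ 2) • (J1 + s • (Jm * (Q1 - Q * Q)))
      + (8 * s * k ^ 3) • Q
      - (8 * Complex.I * s * k ^ 4) • Jm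
      + (3 * Complex.I * s) • (Jm * (Q1 * (Q * Q) + (Q * Q) * Q1))
      + (Complex.I * s) • (Jm * (Q2 * Q + Q * Q2 - Q3 - Q1 * Q1))
      + (Complex.I * (1 + 3 * s * n)) • (Jm * (Q * Q))
      - Complex.I • (Jm * Q1)

/-- The `x`-derivative of `E` as a function of the jet of `Q`. -/
noncomputable def DEj (s k n n' : ℂ) (Q Q1 Q2 Q3 Q4 : Matrix (Fin 3) (Fin 3) ℂ) :
    Matrix (Fin 3) (Fin 3) ℂ :=
  (2 * k) • (s • ((Q2 * Q + Q1 * Q1) - (Q1 * Q1 + Q * Q2))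
        - ((2 * s * n') • Q + (2 * s * n) • Q1) - s • Q3 - Q1)
      + 0
      + 0
      + (4 * Complex.I * k ^ 2) • (0 + s • (Jm * (Q2 - (Q1 * Q + Q * Q1))))
      + (8 * s * k ^ 3) • Q1
      - 0
      + (3 * Complex.I * s) • (Jm * ((Q2 * (Q * Q) + Q1 * (Q1 * Q + Q * Q1))
          + ((Q1 * Q + Q * Q1) * Q1 + (Q * Q) * Q2)))
      + (Complex.I * s) • (Jm * ((Q3 * Q + Q2 * Q1) + (Q1 * Q2 + Q * Q3) - Q4
          - (Q2 * Q1 + Q1 * Q2)))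
      + ((Complex.I * (3 * s * n')) • (Jm * (Q * Q))
          + (Complex.I * (1 + 3 * s * n)) • (Jm * (Q1 * Q + Q * Q1)))
      - Complex.I • (Jm * Q2)

theorem hd_Ej (s c k : ℂ) {n : ℝ → ℂ} {n' : ℂ} {Q Q1 Q2 Q3 : ℝ → Matrix (Fin 3) (Fin 3) ℂ}
    {Q4 : Matrix (Fin 3) (Fin 3) ℂ} {x : ℝ} (hn : HasDerivAt n n' x)
    (d0 : HD Q (Q1 x) x) (d1 : HD Q1 (Q2 x) x) (d2 : HD Q2 (Q3 x) x) (d3 : HD Q3 Q4 x) :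
    HD (fun y => Ej s c k (n y) (Q y) (Q1 y) (Q2 y) (Q3 y))
      (DEj s k (n x) n' (Q x) (Q1 x) (Q2 x) (Q3 x) Q4) x := by
  unfold Ej DEj
  refine HD.sub (HD.add (HD.add (HD.add (HD.sub (HD.add (HD.add (HD.add (HD.add ?_ ?_) ?_) ?_)
    ?_) ?_) ?_) ?_) ?_) ?_
  · exact (((((d1.mul d0).sub (d0.mul d1)).csmul s).sub
      (HD.smul (hn.const_mul (2 * s)) d0)).sub (d2.csmul s)).sub d0 |>.csmul _
  · exact HD.const _ x
  · exact HD.const _ x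
  · exact ((HD.const J1 x).add (((d1.sub (d0.mul d0)).cmul Jm).csmul s)).csmul _
  · exact d0.csmul _
  · exact HD.const _ x
  · exact (((d1.mul (d0.mul d0)).add ((d0.mul d0).mul d1)).cmul Jm).csmul _
  · exact (((((d2.mul d0).add (d0.mul d2)).sub d3).sub (d1.mul d1)).cmul Jm).csmul _
  · exact HD.smul (((hn.const_mul (3 * s)).const_add 1).const_mul Complex.I)
      ((d0.mul d0).cmul Jm)
  · exact (d1.cmul Jm).csmul _

/-- `Q` with the conjugates as independent variables. -/
noncomputable def QQ (a b A B : ℂ) : Matrix (Fin 3) (Fin 3) ℂ :=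
  !![0, A, B; -a, 0, 0; -b, 0, 0]

theorem Jm_eq : Jm = !![1, 0, 0; 0, -1, 0; 0, 0, -1] := by
  ext i j
  fin_cases i <;> fin_cases j <;> simp [Jm]

theorem J1_eq : J1 = !![1, 0, 0; 0, 0, 0; 0, 0, 0] := by
  ext i j
  fin_cases i <;> fin_cases j <;> simp [J1]

set_option maxHeartbeats 4000000 in
theorem alg (s c k a0 b0 A0 B0 a1 b1 A1 B1 a2 b2 A2 B2 a3 b3 A3 B3 a4 b4 A4 B4 at' bt' At' Bt' : ℂ)
    (ha : at' = Complex.I * (a2 + 2 * ((A0 * a0 + B0 * b0) - c ^ 2) * a0 + s * (a4 + 2 * (A1 * a1 + B1 * b1) * a0 + 2 * (A1 * a0 + B1 * b0) * a1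
      + 6 * (A0 * a1 + B0 * b1) * a1 + 4 * (A0 * a0 + B0 * b0) * a2 + 4 * (A0 * a2 + B0 * b2) * a0
      + 2 * (A2 * a0 + B2 * b0) * a0 + 6 * ((A0 * a0 + B0 * b0) ^ 2 - c ^ 4) * a0)))
    (hb : bt' = Complex.I * (b2 + 2 * ((A0 * a0 + B0 * b0) - c ^ 2) * b0 + s * (b4 + 2 * (A1 * a1 + B1 * b1) * b0 + 2 * (A1 * a0 + B1 * b0) * b1
      + 6 * (A0 * a1 + B0 * b1) * b1 + 4 * (A0 * a0 + B0 * b0) * b2 + 4 * (A0 * a2 + B0 * b2) * b0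
      + 2 * (A2 * a0 + B2 * b0) * b0 + 6 * ((A0 * a0 + B0 * b0) ^ 2 - c ^ 4) * b0)))
    (hA : At' = -Complex.I * (A2 + 2 * ((a0 * A0 + b0 * B0) - c ^ 2) * A0 + s * (A4 + 2 * (a1 * A1 + b1 * B1) * A0 + 2 * (a1 * A0 + b1 * B0) * A1
      + 6 * (a0 * A1 + b0 * B1) * A1 + 4 * (a0 * A0 + b0 * B0) * A2 + 4 * (a0 * A2 + b0 * B2) * A0
      + 2 * (a2 * A0 + b2 * B0) * A0 + 6 * ((a0 * A0 + b0 * B0) ^ 2 - c ^ 4) * A0)))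
    (hB : Bt' = -Complex.I * (B2 + 2 * ((a0 * A0 + b0 * B0) - c ^ 2) * B0 + s * (B4 + 2 * (a1 * A1 + b1 * B1) * B0 + 2 * (a1 * A0 + b1 * B0) * B1
      + 6 * (a0 * A1 + b0 * B1) * B1 + 4 * (a0 * A0 + b0 * B0) * B2 + 4 * (a0 * A2 + b0 * B2) * B0
      + 2 * (a2 * A0 + b2 * B0) * B0 + 6 * ((a0 * A0 + b0 * B0) ^ 2 - c ^ 4) * B0))) :
    QQ at' bt' At' Bt'
      - DEj s k (A0 * a0 + B0 * b0) ((A1 * a0 + B1 * b0) + (A0 * a1 + B0 * b1))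
          (QQ a0 b0 A0 B0) (QQ a1 b1 A1 B1) (QQ a2 b2 A2 B2) (QQ a3 b3 A3 B3) (QQ a4 b4 A4 B4)
      + ((-(Complex.I * k)) • Jm + QQ a0 b0 A0 B0) *
          Ej s c k (A0 * a0 + B0 * b0)
            (QQ a0 b0 A0 B0) (QQ a1 b1 A1 B1) (QQ a2 b2 A2 B2) (QQ a3 b3 A3 B3)
      - Ej s c k (A0 * a0 + B0 * b0)
            (QQ a0 b0 A0 B0) (QQ a1 b1 A1 B1) (QQ a2 b2 A2 B2) (QQ a3 b3 A3 B3) *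
          ((-(Complex.I * k)) • Jm + QQ a0 b0 A0 B0) = 0 := by
  have hI : Complex.I ^ 2 = -1 := Complex.I_sq
  subst ha hb hA hB
  unfold Ej DEj
  rw [Jm_eq, J1_eq]
  generalize Complex.I = I at *
  ext i j
  fin_cases i <;> fin_cases j <;>
    simp [QQ] <;> ring_nf <;>
    simp only [hI] <;> ring

/-- Zero-curvature condition (eqs. (2.1)–(2.4)): if the smooth field `q` satisfies the
coupled LPD equation with background `q₀`, then `∂_t A − ∂_x E + [A, E] = 0`. -/
theorem stmt10 (σ q₀ : ℝ) (hq₀ : 0 ≤ q₀) (k : ℂ) (q : ℝ → ℝ → Fin 2 → ℂ)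
    (hsmooth : ContDiff ℝ (⊤ : ℕ∞) (Function.uncurry q)) (hLPD : LPD σ q₀ q) :
    ∀ x t : ℝ,
      DtM (Amat k q) x t - DxM (Emat σ q₀ k q) x t
        + Amat k q x t * Emat σ q₀ k q x t - Emat σ q₀ k q x t * Amat k q x t = 0 := by
  intro x t
  have s0 : Sm q := hsmooth
  have s1 := s0.dx
  have s2 := s1.dx
  have s3 := s2.dx
  have hA : DtM (Amat k q) x t = Qm (Dt q x t) := by
    have := (HD.const ((-(Complex.I * k)) • Jm) t).add (hd_Qm (s0.ht x t))
    rw [zero_add] at this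
    ext i j
    exact (this i j).deriv
  have hEE : Emat σ q₀ k q = fun x t => Ej σ q₀ k (dagger (q x t) (q x t)) (QM q x t)
      (QM (Dx q) x t) (QM (Dx (Dx q)) x t) (QM (Dx (Dx (Dx q))) x t) := by
    unfold Emat
    rw [s0.dxQ, s1.dxQ, s2.dxQ]
    rfl
  have hE := hd_Ej σ q₀ k (s0.hdag x t) (s0.hdx x t) (s1.hdx x t) (s2.hdx x t) (s3.hdx x t)
  rw [hA, hEE, hE.dxm]
  have e0 := congrFun (hLPD x t) 0
  have e1 := congrFun (hLPD x t) 1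
  have f0 := congrArg (starRingEnd ℂ) e0
  have f1 := congrArg (starRingEnd ℂ) e1
  simp only [dagger, Pi.add_apply, Pi.smul_apply, smul_eq_mul, Pi.zero_apply, map_add, map_mul,
    map_sub, map_pow, map_zero, Complex.conj_I, Complex.conj_ofReal, Complex.conj_conj,
    map_ofNat] at e0 e1 f0 f1
  have hI : Complex.I ^ 2 = -1 := Complex.I_sq
  refine alg (σ : ℂ) (q₀ : ℂ) k (q x t 0) (q x t 1) (starRingEnd ℂ (q x t 0)) (starRingEnd ℂ (q x t 1))
    (Dx q x t 0) (Dx q x t 1) (starRingEnd ℂ (Dx q x t 0)) (starRingEnd ℂ (Dx q x t 1))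
    (Dx (Dx q) x t 0) (Dx (Dx q) x t 1) (starRingEnd ℂ (Dx (Dx q) x t 0)) (starRingEnd ℂ (Dx (Dx q) x t 1))
    (Dx (Dx (Dx q)) x t 0) (Dx (Dx (Dx q)) x t 1) (starRingEnd ℂ (Dx (Dx (Dx q)) x t 0)) (starRingEnd ℂ (Dx (Dx (Dx q)) x t 1))
    (Dx (Dx (Dx (Dx q))) x t 0) (Dx (Dx (Dx (Dx q))) x t 1) (starRingEnd ℂ (Dx (Dx (Dx (Dx q))) x t 0)) (starRingEnd ℂ (Dx (Dx (Dx (Dx q))) x t 1))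
    (Dt q x t 0) (Dt q x t 1) (starRingEnd ℂ (Dt q x t 0)) (starRingEnd ℂ (Dt q x t 1)) ?_ ?_ ?_ ?_
  · linear_combination (-Complex.I) * e0 + Dt q x t 0 * hI
  · linear_combination (-Complex.I) * e1 + Dt q x t 1 * hI
  · linear_combination Complex.I * f0 + starRingEnd ℂ (Dt q x t 0) * hI
  · linear_combination Complex.I * f1 + starRingEnd ℂ (Dt q x t 1) * hI
end
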